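/- arXiv:2401.16836 — 3 statements merged into one kernel-verified Lean document; each statement's English description precedes it below -/
import Mathlib

section
/- Let A ∈ ℝ_+^{m×n×p} satisfy A = Π1 * [[S, S*H],[M*S, M*S*H]] * Π2 for permutation tensors Π1 ∈ ℝ^{m×m×p}, Π2 ∈ ℝ^{n×n×p} and nonnegative tensors S ∈ ℝ_+^{r1×r2×p}, M ∈ ℝ_+^{(m−r1)×r1×p}, H ∈ ℝ_+^{r2×(n−r2)×p}. Define X := Π1 * [[I_{r1}, O],[M, O]] * Π1ᵀ ∈ ℝ_+^{m×m×p} and Y := Π2ᵀ * [[I_{r2}, H],[O, O]] * Π2 ∈ ℝ_+^{n×n×p}, where O denotes a zero tensor of the appropriate size. Then X * A = A, A * Y = A, and consequently A = X * A * Y. -/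
open Matrix BigOperators Kronecker

namespace CoSepNTF

noncomputable section

variable {p : ℕ}

/-- The t-product of third-order tensors, represented by their `Fin p`-indexed frontal
slices: `(A * B)_{::s} = ∑ t, A_{::(s-t mod p)} ⬝ B_{::t}`, which is exactly
`fold (bcirc A ⬝ unfold B)`. -/
def tprod {α β γ : Type*} [Fintype β] (A : Fin p → Matrix α β ℝ)
    (B : Fin p → Matrix β γ ℝ) : Fin p → Matrix α γ ℝ :=
  fun s => ∑ t : Fin p, A (s - t) * B t

/-- The identity tensor: first frontal slice the identity, other slices zero. -/
def tId (n p : ℕ) [NeZero p] : Fin p → Matrix (Fin n) (Fin n) ℝ :=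
  fun k => if k = 0 then 1 else 0

/-- Tensor transpose: `(Aᵀ)_{::k} = (A_{::(p-k+2)})ᵀ` (1-based), i.e. slice `-k` (0-based). -/
def tT {α β : Type*} [NeZero p] (A : Fin p → Matrix α β ℝ) : Fin p → Matrix β α ℝ :=
  fun k => (A (-k))ᵀ

/-- A tensor is nonnegative if all its entries are nonnegative. -/
def Nonneg {α β : Type*} (A : Fin p → Matrix α β ℝ) : Prop := ∀ k i j, 0 ≤ A k i j

/-- Horizontal subtensor `A_{I::}` given by a row-selection map `ι`. -/
def rsub {α α' β : Type*} (ι : α' → α) (A : Fin p → Matrix α β ℝ) : Fin p → Matrix α' β ℝ :=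
  fun k => (A k).submatrix ι id

/-- Lateral subtensor `A_{:J:}` given by a column-selection map `κ`. -/
def csub {α β β' : Type*} (κ : β' → β) (A : Fin p → Matrix α β ℝ) : Fin p → Matrix α β' ℝ :=
  fun k => (A k).submatrix id κ

/-- Subtensor `A_{IJ:}`. -/
def coreSub {α α' β β' : Type*} (ι : α' → α) (κ : β' → β) (A : Fin p → Matrix α β ℝ) :
    Fin p → Matrix α' β' ℝ := fun k => (A k).submatrix ι κ

/-- `A` is co-(r1,r2)-separable with core `A_{IJ:}` for the index sets given by `ι, κ`. -/
def CoseparableWithCore {m n r1 r2 : ℕ} [NeZero p] (ι : Fin r1 → Fin m) (κ : Fin r2 → Fin n)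
    (A : Fin p → Matrix (Fin m) (Fin n) ℝ) : Prop :=
  ∃ (P1 : Fin p → Matrix (Fin m) (Fin r1) ℝ) (P2 : Fin p → Matrix (Fin r2) (Fin n) ℝ),
    Nonneg P1 ∧ Nonneg P2 ∧ rsub ι P1 = tId r1 p ∧ csub κ P2 = tId r2 p ∧
    A = tprod (tprod P1 (coreSub ι κ A)) P2

/-- `A` is co-(r1,r2)-separable. -/
def Coseparable {m n : ℕ} [NeZero p] (r1 r2 : ℕ) (A : Fin p → Matrix (Fin m) (Fin n) ℝ) : Prop :=
  ∃ (ι : Fin r1 → Fin m) (κ : Fin r2 → Fin n),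
    Function.Injective ι ∧ Function.Injective κ ∧ CoseparableWithCore ι κ A

/-- A permutation tensor: first frontal slice a permutation matrix, other slices zero. -/
def IsPermTensor {n : ℕ} [NeZero p] (Q : Fin p → Matrix (Fin n) (Fin n) ℝ) : Prop :=
  (∃ σ : Equiv.Perm (Fin n), Q 0 = σ.permMatrix ℝ) ∧ ∀ k, k ≠ 0 → Q k = 0

/-- 2×2 block tensor `[[A11, A12],[A21, A22]]` of size `m × n × p` (where `r1 ≤ m`, `r2 ≤ n`),
formed by block concatenation of each frontal slice. -/
def blockT {m n r1 r2 : ℕ} (hm : r1 ≤ m) (hn : r2 ≤ n)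
    (A11 : Fin p → Matrix (Fin r1) (Fin r2) ℝ)
    (A12 : Fin p → Matrix (Fin r1) (Fin (n - r2)) ℝ)
    (A21 : Fin p → Matrix (Fin (m - r1)) (Fin r2) ℝ)
    (A22 : Fin p → Matrix (Fin (m - r1)) (Fin (n - r2)) ℝ) :
    Fin p → Matrix (Fin m) (Fin n) ℝ :=
  fun k => (Matrix.fromBlocks (A11 k) (A12 k) (A21 k) (A22 k)).submatrix
    (fun i => finSumFinEquiv.symm (Fin.cast (Nat.add_sub_cancel' hm).symm i))
    (fun j => finSumFinEquiv.symm (Fin.cast (Nat.add_sub_cancel' hn).symm j))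

/-- The block circulant matrix of a tensor: block `(s,t)` is `A_{::((s-t) mod p)}`. -/
def bcirc {α β : Type*} (A : Fin p → Matrix α β ℝ) : Matrix (Fin p × α) (Fin p × β) ℝ :=
  Matrix.of fun si tj => A (si.1 - tj.1) si.2 tj.2

/-- The unfolding of a tensor into a block-column matrix. -/
def unfoldT {α β : Type*} (A : Fin p → Matrix α β ℝ) : Matrix (Fin p × α) β ℝ :=
  Matrix.of fun ki j => A ki.1 ki.2 j

/-- Squared Frobenius norm of a real tensor. -/
def frobSq {α β : Type*} [Fintype α] [Fintype β] (A : Fin p → Matrix α β ℝ) : ℝ :=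
  ∑ k, ∑ i, ∑ j, (A k i j) ^ 2

/-- Squared Frobenius norm of a complex tensor. -/
def frobSqC {α β : Type*} [Fintype α] [Fintype β] (A : Fin p → Matrix α β ℂ) : ℝ :=
  ∑ k, ∑ i, ∑ j, ‖A k i j‖ ^ 2

/-- Squared Frobenius norm of a real matrix. -/
def matFrobSq {α β : Type*} [Fintype α] [Fintype β] (M : Matrix α β ℝ) : ℝ :=
  ∑ i, ∑ j, (M i j) ^ 2

/-- The discrete Fourier transform of a tensor along the third dimension:
`Â_{::k} = ∑ j, ω_p^(jk) A_{::j}` with `ω_p = exp(-2πi/p)`. -/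
def fft {α β : Type*} (A : Fin p → Matrix α β ℝ) : Fin p → Matrix α β ℂ :=
  fun k => ∑ j : Fin p,
    (Complex.exp (-2 * (Real.pi : ℂ) * Complex.I / (p : ℂ)) ^ ((j : ℕ) * (k : ℕ))) •
      (A j).map Complex.ofReal

/-- The spectral (ℓ²-operator) norm of a complex matrix. -/
def specNorm {α β : Type*} [Fintype α] [Fintype β] [DecidableEq β] (M : Matrix α β ℂ) : ℝ :=
  ‖LinearMap.toContinuousLinearMap (Matrix.toEuclideanLin M)‖

/-- The tensor spectral norm: `‖A‖₂ = max_k ‖Â_{::k}‖₂`. -/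
def tSpecNorm {α β : Type*} [Fintype α] [Fintype β] [DecidableEq β]
    (A : Fin p → Matrix α β ℝ) : ℝ :=
  ⨆ k, specNorm (fft A k)

/-- The unitary DFT matrix `F_p = (1/√p)(ω_p^{jk})`. -/
def dftMatrix (p : ℕ) : Matrix (Fin p) (Fin p) ℂ :=
  Matrix.of fun j k =>
    (((Real.sqrt p)⁻¹ : ℝ) : ℂ) *
      Complex.exp (-2 * (Real.pi : ℂ) * Complex.I / (p : ℂ)) ^ ((j : ℕ) * (k : ℕ))

/-- The block diagonal matrix `diag(Â_{::1}, …, Â_{::p})`. -/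
def fftBD {α β : Type*} (A : Fin p → Matrix α β ℝ) : Matrix (Fin p × α) (Fin p × β) ℂ :=
  Matrix.of fun ki lj => if ki.1 = lj.1 then fft A ki.1 ki.2 lj.2 else 0

/-- The square of the smallest nonzero singular value of `M`, i.e. the smallest nonzero
eigenvalue of `Mᴴ * M`. -/
def sigmaMinSq {α β : Type*} [Fintype α] [Fintype β] (M : Matrix α β ℂ) : ℝ :=
  sInf {t : ℝ | t ≠ 0 ∧ ∃ v : β → ℂ, v ≠ 0 ∧ (Mᴴ * M) *ᵥ v = (t : ℂ) • v}


theorem tprod_assoc {α β γ δ : Type*} [Fintype β] [Fintype γ] [NeZero p]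
    (A : Fin p → Matrix α β ℝ) (B : Fin p → Matrix β γ ℝ) (C : Fin p → Matrix γ δ ℝ) :
    tprod (tprod A B) C = tprod A (tprod B C) := by
  funext s
  simp only [tprod, Matrix.sum_mul, Matrix.mul_sum]
  conv_rhs => rw [Finset.sum_comm]
  refine Finset.sum_congr rfl fun t _ => ?_
  refine Fintype.sum_equiv (Equiv.addRight t) _ _ fun u => ?_
  simp [Matrix.mul_assoc, sub_sub, add_comm]

theorem zero_tprod {α β γ : Type*} [Fintype β] (B : Fin p → Matrix β γ ℝ) :
    tprod (0 : Fin p → Matrix α β ℝ) B = 0 := by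
  funext s
  simp [tprod]

theorem tprod_zero {α β γ : Type*} [Fintype β] (A : Fin p → Matrix α β ℝ) :
    tprod A (0 : Fin p → Matrix β γ ℝ) = 0 := by
  funext s
  simp [tprod]

theorem tId_tprod {n : ℕ} {γ : Type*} [NeZero p] (B : Fin p → Matrix (Fin n) γ ℝ) :
    tprod (tId n p) B = B := by
  funext s
  rw [tprod, Finset.sum_eq_single s
    (fun t _ ht => by simp [tId, sub_eq_zero, ht.symm]) (by simp)]
  simp [tId]

theorem tprod_tId {n : ℕ} {α : Type*} [NeZero p] (A : Fin p → Matrix α (Fin n) ℝ) :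
    tprod A (tId n p) = A := by
  funext s
  rw [tprod, Finset.sum_eq_single 0 (fun t _ ht => by simp [tId, ht]) (by simp)]
  simp [tId]

theorem IsPermTensor.tT_tprod_self {n : ℕ} [NeZero p] {Q : Fin p → Matrix (Fin n) (Fin n) ℝ}
    (hQ : IsPermTensor Q) : tprod (tT Q) Q = tId n p := by
  obtain ⟨⟨σ, hσ⟩, h0⟩ := hQ
  funext s
  rw [tprod, Finset.sum_eq_single 0 (fun t _ ht => by simp [h0 t ht]) (by simp)]
  by_cases hs : s = 0
  · simp [hs, tT, tId, hσ, Matrix.transpose_permMatrix, ← Matrix.permMatrix_mul]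
  · simp [hs, tT, tId, h0]

theorem IsPermTensor.tprod_tT_self {n : ℕ} [NeZero p] {Q : Fin p → Matrix (Fin n) (Fin n) ℝ}
    (hQ : IsPermTensor Q) : tprod Q (tT Q) = tId n p := by
  obtain ⟨⟨σ, hσ⟩, h0⟩ := hQ
  funext s
  rw [tprod, Finset.sum_eq_single 0
    (fun t _ ht => by simp [tT, h0 (-t) (neg_ne_zero.mpr ht)]) (by simp)]
  by_cases hs : s = 0
  · simp [hs, tT, tId, hσ, Matrix.transpose_permMatrix, ← Matrix.permMatrix_mul]
  · simp [hs, tT, tId, h0]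

theorem blockT_tprod_blockT {l m n r1 r2 r3 : ℕ} (hl : r1 ≤ l) (hm : r2 ≤ m) (hn : r3 ≤ n)
    (A11 : Fin p → Matrix (Fin r1) (Fin r2) ℝ)
    (A12 : Fin p → Matrix (Fin r1) (Fin (m - r2)) ℝ)
    (A21 : Fin p → Matrix (Fin (l - r1)) (Fin r2) ℝ)
    (A22 : Fin p → Matrix (Fin (l - r1)) (Fin (m - r2)) ℝ)
    (B11 : Fin p → Matrix (Fin r2) (Fin r3) ℝ)
    (B12 : Fin p → Matrix (Fin r2) (Fin (n - r3)) ℝ)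
    (B21 : Fin p → Matrix (Fin (m - r2)) (Fin r3) ℝ)
    (B22 : Fin p → Matrix (Fin (m - r2)) (Fin (n - r3)) ℝ) :
    tprod (blockT hl hm A11 A12 A21 A22) (blockT hm hn B11 B12 B21 B22) =
      blockT hl hn (tprod A11 B11 + tprod A12 B21) (tprod A11 B12 + tprod A12 B22)
        (tprod A21 B11 + tprod A22 B21) (tprod A21 B12 + tprod A22 B22) := by
  have key : ∀ s t,
      blockT hl hm A11 A12 A21 A22 s * blockT hm hn B11 B12 B21 B22 t =
        (Matrix.fromBlocks (A11 s * B11 t + A12 s * B21 t) (A11 s * B12 t + A12 s * B22 t)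
          (A21 s * B11 t + A22 s * B21 t) (A21 s * B12 t + A22 s * B22 t)).submatrix
          (fun i => finSumFinEquiv.symm (Fin.cast (Nat.add_sub_cancel' hl).symm i))
          (fun j => finSumFinEquiv.symm (Fin.cast (Nat.add_sub_cancel' hn).symm j)) := by
    intro s t
    rw [← Matrix.fromBlocks_multiply]
    exact Matrix.submatrix_mul_equiv _ _ _
      ((finCongr (Nat.add_sub_cancel' hm).symm).trans finSumFinEquiv.symm) _
  funext s
  ext i j
  simp only [tprod, key]
  simp only [blockT, Matrix.sum_apply, Matrix.submatrix_apply, Pi.add_apply]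
  rcases finSumFinEquiv.symm (Fin.cast (Nat.add_sub_cancel' hl).symm i) with a | a <;>
    rcases finSumFinEquiv.symm (Fin.cast (Nat.add_sub_cancel' hn).symm j) with b | b <;>
    simp [tprod, Matrix.sum_apply, Finset.sum_add_distrib]

/-- Proposition 3.2, (ii) ⇒ (iii),(iv): if
`A = Pi1 * [[S, S*H],[M*S, M*S*H]] * Pi2` with `Pi1, Pi2` permutation tensors and
`S, M, H` nonnegative, then for `X = Pi1 * [[I,O],[M,O]] * Pi1ᵀ` and
`Y = Pi2ᵀ * [[I,H],[O,O]] * Pi2` one has `X * A = A`, `A * Y = A`, and `A = X * A * Y`. -/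
theorem block_form_absorbing {m n p r1 r2 : ℕ} [NeZero p]
    (A : Fin p → Matrix (Fin m) (Fin n) ℝ) (hA : Nonneg A)
    (hm : r1 ≤ m) (hn : r2 ≤ n)
    (Pi1 : Fin p → Matrix (Fin m) (Fin m) ℝ) (Pi2 : Fin p → Matrix (Fin n) (Fin n) ℝ)
    (hPi1 : IsPermTensor Pi1) (hPi2 : IsPermTensor Pi2)
    (S : Fin p → Matrix (Fin r1) (Fin r2) ℝ)
    (M : Fin p → Matrix (Fin (m - r1)) (Fin r1) ℝ)
    (H : Fin p → Matrix (Fin r2) (Fin (n - r2)) ℝ)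
    (hS : Nonneg S) (hM : Nonneg M) (hH : Nonneg H)
    (hfac : A = tprod (tprod Pi1
      (blockT hm hn S (tprod S H) (tprod M S) (tprod (tprod M S) H))) Pi2)
    (X : Fin p → Matrix (Fin m) (Fin m) ℝ)
    (hX : X = tprod (tprod Pi1 (blockT hm hm (tId r1 p) 0 M 0)) (tT Pi1))
    (Y : Fin p → Matrix (Fin n) (Fin n) ℝ)
    (hY : Y = tprod (tprod (tT Pi2) (blockT hn hn (tId r2 p) H 0 0)) Pi2) :
    tprod X A = A ∧ tprod A Y = A ∧ A = tprod (tprod X A) Y := by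
  have hXA : tprod X A = A := by
    have hB : tprod (blockT hm hm (tId r1 p) 0 M 0)
        (blockT hm hn S (tprod S H) (tprod M S) (tprod (tprod M S) H)) =
        blockT hm hn S (tprod S H) (tprod M S) (tprod (tprod M S) H) := by
      simp [blockT_tprod_blockT, tId_tprod, zero_tprod, tprod_assoc]
    rw [hX, hfac, tprod_assoc Pi1 _ Pi2, tprod_assoc _ (tT Pi1), ← tprod_assoc (tT Pi1),
      hPi1.tT_tprod_self, tId_tprod, tprod_assoc Pi1, ← tprod_assoc _ _ Pi2, hB]
  have hAY : tprod A Y = A := by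
    have hB : tprod (blockT hm hn S (tprod S H) (tprod M S) (tprod (tprod M S) H))
        (blockT hn hn (tId r2 p) H 0 0) =
        blockT hm hn S (tprod S H) (tprod M S) (tprod (tprod M S) H) := by
      simp [blockT_tprod_blockT, tprod_tId, tprod_zero]
    rw [hY, hfac, tprod_assoc (tT Pi2), tprod_assoc _ Pi2, ← tprod_assoc Pi2 (tT Pi2),
      hPi2.tprod_tT_self, tId_tprod, tprod_assoc Pi1, ← tprod_assoc _ _ Pi2, hB,
      ← tprod_assoc Pi1]
  exact ⟨hXA, hAY, by rw [hXA, hAY]⟩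

end

end CoSepNTF
end

section
/- Let A ∈ ℝ_+^{m×n×p} be nonnegative, let Π1 ∈ ℝ^{m×m×p}, Π2 ∈ ℝ^{n×n×p} be permutation tensors, and let M ∈ ℝ_+^{(m−r1)×r1×p}, H ∈ ℝ_+^{r2×(n−r2)×p} be nonnegative. Set X := Π1 * [[I_{r1}, O],[M, O]] * Π1ᵀ and Y := Π2ᵀ * [[I_{r2}, H],[O, O]] * Π2, where O denotes a zero tensor of the appropriate size. If A = X * A * Y, then A is co-(r1,r2)-separable. -/
open Matrix BigOperators Kronecker

namespace CoSepNTF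

noncomputable section

variable {p : ℕ}

theorem tprod_eq_of_left_slices_zero {α β γ : Type*} [Fintype β] [NeZero p]
    (Q : Fin p → Matrix α β ℝ) (B : Fin p → Matrix β γ ℝ) (hQ : ∀ k, k ≠ 0 → Q k = 0) :
    tprod Q B = fun k => Q 0 * B k := by
  funext s
  unfold tprod
  rw [Finset.sum_eq_single s]
  · rw [sub_self]
  · intro t _ ht
    rw [hQ _ (sub_ne_zero.mpr ht.symm), Matrix.zero_mul]
  · simp

theorem tprod_eq_of_right_slices_zero {α β γ : Type*} [Fintype β] [NeZero p]
    (B : Fin p → Matrix α β ℝ) (Q : Fin p → Matrix β γ ℝ) (hQ : ∀ k, k ≠ 0 → Q k = 0) :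
    tprod B Q = fun k => B k * Q 0 := by
  funext s
  unfold tprod
  rw [Finset.sum_eq_single 0]
  · rw [sub_zero]
  · intro t _ ht
    rw [hQ _ ht, Matrix.mul_zero]
  · simp

theorem tT_slices_zero {α β : Type*} [NeZero p] {Q : Fin p → Matrix α β ℝ}
    (hQ : ∀ k, k ≠ 0 → Q k = 0) (k : Fin p) (hk : k ≠ 0) : tT Q k = 0 := by
  rw [tT, hQ _ (neg_ne_zero.mpr hk), Matrix.transpose_zero]

/-- Conjugating by a permutation tensor relabels the rows and columns of every slice. -/
theorem tprod_perm_conj {n : ℕ} [NeZero p] {Q : Fin p → Matrix (Fin n) (Fin n) ℝ}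
    {σ : Equiv.Perm (Fin n)} (h0 : Q 0 = σ.permMatrix ℝ) (hQ : ∀ k, k ≠ 0 → Q k = 0)
    (B : Fin p → Matrix (Fin n) (Fin n) ℝ) :
    tprod (tprod Q B) (tT Q) = fun k => (B k).submatrix σ σ := by
  rw [tprod_eq_of_right_slices_zero _ _ (tT_slices_zero hQ),
    tprod_eq_of_left_slices_zero _ _ hQ]
  funext k
  ext i j
  simp [tT, h0, Matrix.mul_apply, Equiv.Perm.permMatrix, PEquiv.toMatrix_apply,
    Equiv.symm_apply_eq]

theorem tprod_perm_conj' {n : ℕ} [NeZero p] {Q : Fin p → Matrix (Fin n) (Fin n) ℝ}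
    {σ : Equiv.Perm (Fin n)} (h0 : Q 0 = σ.permMatrix ℝ) (hQ : ∀ k, k ≠ 0 → Q k = 0)
    (B : Fin p → Matrix (Fin n) (Fin n) ℝ) :
    tprod (tprod (tT Q) B) Q = fun k => (B k).submatrix σ.symm σ.symm := by
  rw [tprod_eq_of_right_slices_zero _ _ hQ,
    tprod_eq_of_left_slices_zero _ _ (tT_slices_zero hQ)]
  funext k
  ext i j
  obtain ⟨i, rfl⟩ := σ.surjective i
  obtain ⟨j, rfl⟩ := σ.surjective j
  simp [tT, h0, Matrix.mul_apply, Equiv.Perm.permMatrix, PEquiv.toMatrix_apply]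

/-- A left factor whose columns vanish outside a block only sees the matching rows. -/
theorem tprod_fromCols_zero {α β γ δ ε : Type*} [Fintype β] [Fintype δ] [Fintype ε]
    (φ : β ≃ δ ⊕ ε) (C : Fin p → Matrix α δ ℝ) (A : Fin p → Matrix β γ ℝ) :
    tprod (fun k => (Matrix.fromCols (C k) (0 : Matrix α ε ℝ)).submatrix id φ) A =
      tprod C (rsub (φ.symm ∘ Sum.inl) A) := by
  funext s
  refine Finset.sum_congr rfl fun t _ => ?_
  ext i j
  simp only [Matrix.mul_apply]
  rw [← φ.symm.sum_comp]
  simp [rsub, Fintype.sum_sum_type]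

/-- A right factor whose rows vanish outside a block only sees the matching columns. -/
theorem tprod_fromRows_zero {α β γ δ ε : Type*} [Fintype β] [Fintype δ] [Fintype ε]
    (φ : β ≃ δ ⊕ ε) (C : Fin p → Matrix δ γ ℝ) (A : Fin p → Matrix α β ℝ) :
    tprod A (fun k => (Matrix.fromRows (C k) (0 : Matrix ε γ ℝ)).submatrix φ id) =
      tprod (csub (φ.symm ∘ Sum.inl) A) C := by
  funext s
  refine Finset.sum_congr rfl fun t _ => ?_
  ext i j
  simp only [Matrix.mul_apply]
  rw [← φ.symm.sum_comp]
  simp [csub, Fintype.sum_sum_type]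

theorem tId_nonneg (n : ℕ) [NeZero p] : Nonneg (tId n p) := by
  intro k i j
  unfold tId
  split_ifs
  · rw [Matrix.one_apply]
    split_ifs <;> norm_num
  · exact le_rfl

/-- The splitting of `Fin m` into its first `r` and its last `m - r` elements. -/
def splitEquiv {m r : ℕ} (h : r ≤ m) : Fin m ≃ Fin r ⊕ Fin (m - r) :=
  (finCongr (Nat.add_sub_cancel' h).symm).trans finSumFinEquiv.symm

/-- Proposition 3.2, (iii) ⇒ (i): if a nonnegative tensor `A` satisfies
`A = X * A * Y` with `X = Pi1 * [[I,O],[M,O]] * Pi1ᵀ` and `Y = Pi2ᵀ * [[I,H],[O,O]] * Pi2`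
for permutation tensors `Pi1, Pi2` and nonnegative `M, H`, then `A` is
co-(r1,r2)-separable. -/
theorem coseparable_of_XAY {m n p r1 r2 : ℕ} [NeZero p]
    (A : Fin p → Matrix (Fin m) (Fin n) ℝ) (hA : Nonneg A)
    (hm : r1 ≤ m) (hn : r2 ≤ n)
    (Pi1 : Fin p → Matrix (Fin m) (Fin m) ℝ) (Pi2 : Fin p → Matrix (Fin n) (Fin n) ℝ)
    (hPi1 : IsPermTensor Pi1) (hPi2 : IsPermTensor Pi2)
    (M : Fin p → Matrix (Fin (m - r1)) (Fin r1) ℝ)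
    (H : Fin p → Matrix (Fin r2) (Fin (n - r2)) ℝ)
    (hM : Nonneg M) (hH : Nonneg H)
    (X : Fin p → Matrix (Fin m) (Fin m) ℝ)
    (hX : X = tprod (tprod Pi1 (blockT hm hm (tId r1 p) 0 M 0)) (tT Pi1))
    (Y : Fin p → Matrix (Fin n) (Fin n) ℝ)
    (hY : Y = tprod (tprod (tT Pi2) (blockT hn hn (tId r2 p) H 0 0)) Pi2)
    (hXAY : A = tprod (tprod X A) Y) :
    Coseparable r1 r2 A := by
  obtain ⟨⟨σ, hσ⟩, hPi1z⟩ := hPi1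
  obtain ⟨⟨τ, hτ⟩, hPi2z⟩ := hPi2
  let φ : Fin m ≃ Fin r1 ⊕ Fin (m - r1) := σ.trans (splitEquiv hm)
  let ψ : Fin n ≃ Fin r2 ⊕ Fin (n - r2) := τ.symm.trans (splitEquiv hn)
  let P1 : Fin p → Matrix (Fin m) (Fin r1) ℝ :=
    fun k => (Matrix.fromRows (tId r1 p k) (M k)).submatrix φ id
  let P2 : Fin p → Matrix (Fin r2) (Fin n) ℝ :=
    fun k => (Matrix.fromCols (tId r2 p k) (H k)).submatrix id ψ
  have hX' : X = fun k =>
      (Matrix.fromCols (P1 k) (0 : Matrix (Fin m) (Fin (m - r1)) ℝ)).submatrix id φ := by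
    rw [hX, tprod_perm_conj hσ hPi1z]
    funext k
    ext i j
    change Matrix.fromBlocks _ _ _ _ (φ i) (φ j) =
      Matrix.fromCols (P1 k) 0 i (φ j)
    rcases hi : φ i with a | a <;> rcases φ j with b | b <;> simp [P1, hi]
  have hY' : Y = fun k =>
      (Matrix.fromRows (P2 k) (0 : Matrix (Fin (n - r2)) (Fin n) ℝ)).submatrix ψ id := by
    rw [hY, tprod_perm_conj' hτ hPi2z]
    funext k
    ext i j
    change Matrix.fromBlocks _ _ _ _ (ψ i) (ψ j) =
      Matrix.fromRows (P2 k) 0 (ψ i) j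
    rcases ψ i with a | a <;> rcases hj : ψ j with b | b <;> simp [P2, hj]
  refine ⟨φ.symm ∘ Sum.inl, ψ.symm ∘ Sum.inl, φ.symm.injective.comp Sum.inl_injective,
    ψ.symm.injective.comp Sum.inl_injective, P1, P2, ?_, ?_, ?_, ?_, ?_⟩
  · intro k i j
    change 0 ≤ Matrix.fromRows (tId r1 p k) (M k) (φ i) j
    rcases φ i with a | a
    · exact tId_nonneg r1 k a j
    · exact hM k a j
  · intro k i j
    change 0 ≤ Matrix.fromCols (tId r2 p k) (H k) i (ψ j)
    rcases ψ j with b | b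
    · exact tId_nonneg r2 k i b
    · exact hH k i b
  · funext k
    ext i j
    simp [rsub, P1]
  · funext k
    ext i j
    simp [csub, P2]
  · rw [hX', hY', tprod_fromCols_zero, tprod_fromRows_zero] at hXAY
    have hcsub : csub (ψ.symm ∘ Sum.inl) (tprod P1 (rsub (φ.symm ∘ Sum.inl) A)) =
        tprod P1 (coreSub (φ.symm ∘ Sum.inl) (ψ.symm ∘ Sum.inl) A) := by
      funext k
      ext i j
      simp [csub, tprod, rsub, coreSub, Matrix.sum_apply, Matrix.mul_apply]
    rw [← hcsub]
    exact hXAY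

end

end CoSepNTF
end

section
/- Let A ∈ ℝ^{m×n×p} and let R = A_{I::} ∈ ℝ^{d×n×p} be the horizontal subtensor formed by the rows indexed by a finite sequence I = (i_1,…,i_d) of elements of {1,…,m} (repetitions allowed), i.e. R_{s::} = A_{i_s::}. Let σ_min(Â) denote the smallest nonzero singular value of the block diagonal matrix diag(Â_{::1},…,Â_{::p}). If ‖Aᵀ * A − Rᵀ * R‖₂ < σ_min(Â)², then rank(R̂_{::k}) = rank(Â_{::k}) for every k ∈ {1,…,p}, i.e. rank_m(R) = rank_m(A). -/
open Matrix BigOperators Kronecker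

namespace CoSepNTF

noncomputable section

variable {p : ℕ}

section DFT

/-- The root of unity `ω_p = exp(-2πi/p)` satisfies `ω_p ^ p = 1`. -/
lemma root_pow_eq_one [NeZero p] :
    Complex.exp (-2 * (Real.pi : ℂ) * Complex.I / (p : ℂ)) ^ p = 1 := by
  have hp : (p : ℂ) ≠ 0 := Nat.cast_ne_zero.mpr (NeZero.ne p)
  rw [← Complex.exp_nat_mul,
    show (p : ℂ) * (-2 * (Real.pi : ℂ) * Complex.I / (p : ℂ)) = -(2 * Real.pi * Complex.I) by
      field_simp,
    Complex.exp_neg, Complex.exp_two_pi_mul_I, inv_one]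

lemma pow_fin_add_mul [NeZero p] {ω : ℂ} (hω : ω ^ p = 1) (a b : Fin p) (k : ℕ) :
    ω ^ (((a + b : Fin p) : ℕ) * k) = ω ^ ((a : ℕ) * k) * ω ^ ((b : ℕ) * k) := by
  rw [pow_mul, pow_mul, pow_mul, ← mul_pow, ← pow_add, Fin.val_add, ← pow_eq_pow_mod _ hω]

lemma star_pow_fin_neg_mul [NeZero p] {ω : ℂ} (hω : ω ^ p = 1) (a : Fin p) (k : ℕ) :
    star (ω ^ (((-a : Fin p) : ℕ) * k)) = ω ^ ((a : ℕ) * k) := by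
  have hmul := pow_fin_add_mul hω a (-a) k
  rw [add_neg_cancel, Fin.val_zero, Nat.zero_mul, pow_zero] at hmul
  have hnorm : ‖ω ^ (((-a : Fin p) : ℕ) * k)‖ = 1 := by
    rw [norm_pow, Complex.norm_eq_one_of_pow_eq_one hω (NeZero.ne p), one_pow]
  rw [eq_inv_of_mul_eq_one_left hmul.symm, Complex.inv_eq_conj hnorm]
  rfl

variable {α α' β γ : Type*}

lemma fft_sub (A B : Fin p → Matrix α β ℝ) (k : Fin p) :
    fft (A - B) k = fft A k - fft B k := by
  ext i j
  simp [fft, Matrix.sum_apply, mul_sub, Finset.sum_sub_distrib]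

lemma fft_rsub (ι : α' → α) (A : Fin p → Matrix α β ℝ) (k : Fin p) :
    fft (rsub ι A) k = (fft A k).submatrix ι id := by
  ext i j
  simp [fft, rsub, Matrix.sum_apply]

lemma fft_tT [NeZero p] (A : Fin p → Matrix α β ℝ) (k : Fin p) :
    fft (tT A) k = (fft A k)ᴴ := by
  ext i j
  simp only [fft, tT, Matrix.sum_apply, Matrix.smul_apply, Matrix.map_apply,
    Matrix.transpose_apply, Matrix.conjTranspose_apply, star_sum, smul_eq_mul, star_mul']
  rw [← Equiv.sum_comp (Equiv.neg (Fin p))]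
  refine Finset.sum_congr rfl fun a _ => ?_
  rw [Equiv.neg_apply, neg_neg, ← star_pow_fin_neg_mul root_pow_eq_one, neg_neg]
  simp

/-- The DFT turns the t-product into the slicewise matrix product. -/
lemma fft_tprod [NeZero p] [Fintype β] (A : Fin p → Matrix α β ℝ) (B : Fin p → Matrix β γ ℝ)
    (k : Fin p) : fft (tprod A B) k = fft A k * fft B k := by
  have hmap (s : Fin p) : (tprod A B s).map Complex.ofReal =
      ∑ t, (A (s - t)).map Complex.ofReal * (B t).map Complex.ofReal := by
    ext i j
    simp [tprod, Matrix.sum_apply, Matrix.mul_apply]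
  simp only [fft, hmap, Finset.smul_sum, Matrix.sum_mul, Matrix.mul_sum]
  rw [Finset.sum_comm]
  refine Finset.sum_congr rfl fun t _ => ?_
  rw [← Equiv.sum_comp (Equiv.addRight t)]
  refine Finset.sum_congr rfl fun a _ => ?_
  simp only [Equiv.coe_addRight, add_sub_cancel_right]
  rw [pow_fin_add_mul root_pow_eq_one, Matrix.smul_mul, Matrix.mul_smul, smul_smul]

end DFT

section Spectral

open scoped ComplexOrder

variable {α β : Type*} [Fintype α] [Fintype β]

lemma sigmaMinSq_le (M : Matrix α β ℂ) {t : ℝ} (ht : t ≠ 0) {v : β → ℂ} (hv : v ≠ 0)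
    (h : (Mᴴ * M) *ᵥ v = (t : ℂ) • v) : sigmaMinSq M ≤ t := by
  refine csInf_le ⟨0, ?_⟩ ⟨ht, v, hv, h⟩
  rintro s ⟨-, w, hw, hs⟩
  have h0 := (Matrix.posSemidef_conjTranspose_mul_self M).dotProduct_mulVec_nonneg w
  have h1 : 0 < star w ⬝ᵥ w := Matrix.dotProduct_star_self_pos_iff.mpr hw
  rw [hs, dotProduct_smul, smul_eq_mul] at h0
  have h2 := (Complex.nonneg_iff.mp h0).1
  rw [Complex.re_ofReal_mul] at h2
  exact nonneg_of_mul_nonneg_left h2 (Complex.pos_iff.mp h1).1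

/-- The smallest nonzero singular value of the block diagonal matrix of Fourier slices bounds
the nonzero singular values of each slice from below. -/
lemma sigmaMinSq_fftBD_le (A : Fin p → Matrix α β ℝ) (k : Fin p) {t : ℝ} (ht : t ≠ 0)
    {v : β → ℂ} (hv : v ≠ 0) (h : ((fft A k)ᴴ * fft A k) *ᵥ v = (t : ℂ) • v) :
    sigmaMinSq (fftBD A) ≤ t := by
  refine sigmaMinSq_le _ ht (v := fun lj => if lj.1 = k then v lj.2 else 0) ?_ ?_
  · intro h0
    exact hv (funext fun j => by simpa using congrFun h0 (k, j))
  · have hA : fftBD A *ᵥ (fun lj => if lj.1 = k then v lj.2 else 0) =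
        fun li => if li.1 = k then (fft A k *ᵥ v) li.2 else 0 := by
      ext ⟨l, i⟩
      by_cases hl : l = k
      · subst hl
        simp [fftBD, Matrix.mulVec, dotProduct, Fintype.sum_prod_type]
      · simp [fftBD, Matrix.mulVec, dotProduct, Fintype.sum_prod_type, hl]
    rw [← Matrix.mulVec_mulVec, hA]
    rw [← Matrix.mulVec_mulVec] at h
    ext ⟨l, j⟩
    by_cases hl : l = k
    · subst hl
      have hj := congrFun h j
      simp only [Matrix.mulVec, dotProduct, Fintype.sum_prod_type, fftBD,
        Matrix.conjTranspose_apply, Matrix.of_apply] at hj ⊢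
      simpa [apply_ite, ite_mul] using hj
    · simp [fftBD, Matrix.mulVec, dotProduct, Fintype.sum_prod_type, hl, apply_ite, ite_mul,
        Ne.symm hl]

variable [DecidableEq β]

lemma re_inner_toEuclideanLin_le (M : Matrix β β ℂ) (x : EuclideanSpace ℂ β) :
    RCLike.re (inner ℂ x (Matrix.toEuclideanLin M x)) ≤ specNorm M * ‖x‖ ^ 2 := by
  have h := (LinearMap.toContinuousLinearMap (Matrix.toEuclideanLin M)).le_opNorm x
  have h' : ‖Matrix.toEuclideanLin M x‖ ≤ specNorm M * ‖x‖ := h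
  calc _ ≤ ‖x‖ * ‖Matrix.toEuclideanLin M x‖ := re_inner_le_norm _ _
    _ ≤ ‖x‖ * (specNorm M * ‖x‖) := by gcongr
    _ = _ := by ring

/-- A Hermitian matrix is bounded below by `σ` on the orthogonal complement of its kernel if
all its nonzero eigenvalues are at least `σ`. -/
lemma mul_norm_sq_le_re_inner {H : Matrix β β ℂ} (hH : H.IsHermitian) {σ : ℝ}
    (hσ : ∀ t : ℝ, t ≠ 0 → ∀ v : β → ℂ, v ≠ 0 → H *ᵥ v = (t : ℂ) • v → σ ≤ t)
    {z : EuclideanSpace ℂ β} (hz : z ∈ (LinearMap.ker (Matrix.toEuclideanLin H))ᗮ) :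
    σ * ‖z‖ ^ 2 ≤ RCLike.re (inner ℂ z (Matrix.toEuclideanLin H z)) := by
  let u := hH.eigenvectorBasis
  have hu (i : β) : Matrix.toEuclideanLin H (u i) = (hH.eigenvalues i : ℂ) • u i := by
    ext j
    have := congrFun (hH.mulVec_eigenvectorBasis i) j
    simpa [u, Matrix.toLpLin_apply] using this
  have hsymm := Matrix.isSymmetric_toEuclideanLin_iff.mpr hH
  have hterm (i : β) : inner ℂ z (u i) * inner ℂ (u i) (Matrix.toEuclideanLin H z) =
      ((hH.eigenvalues i * ‖inner ℂ (u i) z‖ ^ 2 : ℝ) : ℂ) := by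
    rw [← hsymm (u i) z, hu, inner_smul_left, Complex.conj_ofReal, mul_left_comm,
      ← inner_conj_symm z (u i), Complex.conj_mul']
    push_cast
    rfl
  rw [← u.sum_inner_mul_inner, ← u.sum_sq_norm_inner_right z, Finset.mul_sum, map_sum]
  refine Finset.sum_le_sum fun i _ => ?_
  rw [hterm, RCLike.re_eq_complex_re, Complex.ofReal_re]
  by_cases hi : hH.eigenvalues i = 0
  · have hker : u i ∈ LinearMap.ker (Matrix.toEuclideanLin H) := by
      rw [LinearMap.mem_ker, hu, hi, Complex.ofReal_zero, zero_smul]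
    rw [hz (u i) hker]
    simp
  · refine mul_le_mul_of_nonneg_right (hσ _ hi (u i).ofLp ?_ ?_) (sq_nonneg _)
    · intro h0
      exact u.orthonormal.ne_zero i (WithLp.ofLp_injective 2 h0)
    · simpa [u] using hH.mulVec_eigenvectorBasis i

end Spectral

open scoped ComplexOrder in
/-- Row sampling preserves the rank when the Gram matrix moves by less than the smallest nonzero
eigenvalue. -/
lemma rank_submatrix_eq_of_specNorm_lt {α α' β : Type*} [Fintype α] [Fintype α'] [Fintype β]
    [DecidableEq β] (M : Matrix α β ℂ) (ι : α' → α) {σ : ℝ}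
    (hσ : ∀ t : ℝ, t ≠ 0 → ∀ v : β → ℂ, v ≠ 0 → (Mᴴ * M) *ᵥ v = (t : ℂ) • v → σ ≤ t)
    (hclose : specNorm (Mᴴ * M - (M.submatrix ι id)ᴴ * M.submatrix ι id) < σ) :
    (M.submatrix ι id).rank = M.rank := by
  set N := M.submatrix ι id
  have hMN (v : β → ℂ) (hv : M *ᵥ v = 0) : N *ᵥ v = 0 :=
    funext fun i => congrFun hv (ι i)
  have hNM (v : β → ℂ) (hv : N *ᵥ v = 0) : M *ᵥ v = 0 := by
    let K := LinearMap.ker (Matrix.toEuclideanLin (Mᴴ * M))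
    obtain ⟨y, hy, z, hz, hyz⟩ := K.exists_add_mem_mem_orthogonal (WithLp.toLp 2 v)
    have hMy : M *ᵥ y.ofLp = 0 := by
      have : (Mᴴ * M) *ᵥ y.ofLp = 0 := congrArg WithLp.ofLp (LinearMap.mem_ker.mp hy)
      rwa [Matrix.conjTranspose_mul_self_mulVec_eq_zero] at this
    have hv' : v = y.ofLp + z.ofLp := congrArg WithLp.ofLp hyz
    have hNz : N *ᵥ z.ofLp = 0 := by
      rwa [hv', Matrix.mulVec_add, hMN _ hMy, zero_add] at hv
    have hE : Matrix.toEuclideanLin (Mᴴ * M - Nᴴ * N) z =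
        Matrix.toEuclideanLin (Mᴴ * M) z := by
      rw [Matrix.toLpLin_apply, Matrix.toLpLin_apply, Matrix.sub_mulVec,
        ← Matrix.mulVec_mulVec _ Nᴴ, hNz, Matrix.mulVec_zero, sub_zero]
    have hlow := mul_norm_sq_le_re_inner (Matrix.isHermitian_conjTranspose_mul_self M) hσ hz
    have hup := re_inner_toEuclideanLin_le (Mᴴ * M - Nᴴ * N) z
    rw [hE] at hup
    have hz0 : z = 0 := by
      by_contra hne
      have hpos : 0 < ‖z‖ ^ 2 := pow_pos (norm_pos_iff.mpr hne) 2
      exact (mul_lt_mul_of_pos_right hclose hpos).not_ge (hlow.trans hup)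
    rw [hv', hz0, Matrix.mulVec_add, hMy]
    simp
  have hker : LinearMap.ker N.mulVecLin = LinearMap.ker M.mulVecLin := by
    ext v
    exact ⟨hNM v, hMN v⟩
  have h1 := N.mulVecLin.finrank_range_add_finrank_ker
  have h2 := M.mulVecLin.finrank_range_add_finrank_ker
  rw [hker] at h1
  exact Nat.add_right_cancel (h1.trans h2.symm)

/-- rank preservation under row sampling, from the proof of Theorem 4.2:
if `R = A_{I::}` is a row-sampled subtensor (rows `I = (i_1, …, i_d)`, repetitions allowed)
and `‖Aᵀ * A − Rᵀ * R‖₂ < σ_min(Â)²` (with `σ_min` the smallest nonzero singular value of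
the block diagonal matrix `diag(Â_{::1}, …, Â_{::p})`), then
`rank(R̂_{::k}) = rank(Â_{::k})` for every `k`, i.e. `rank_m(R) = rank_m(A)`. -/
theorem multirank_preserved_of_close {m n p d : ℕ} [NeZero p]
    (A : Fin p → Matrix (Fin m) (Fin n) ℝ) (I : Fin d → Fin m)
    (hclose : tSpecNorm (tprod (tT A) A - tprod (tT (rsub I A)) (rsub I A)) <
      sigmaMinSq (fftBD A)) :
    ∀ k, (fft (rsub I A) k).rank = (fft A k).rank := by
  intro k
  rw [fft_rsub]
  refine rank_submatrix_eq_of_specNorm_lt _ I (fun t ht v hv h => sigmaMinSq_fftBD_le A k ht hv h)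
    (lt_of_le_of_lt ?_ hclose)
  rw [← fft_rsub, ← fft_tT, ← fft_tT, ← fft_tprod, ← fft_tprod, ← fft_sub]
  exact le_ciSup (f := fun l => specNorm (fft _ l)) (Set.finite_range _).bddAbove k

end

end CoSepNTF
end
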